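/- arXiv:1609.09392 — 2 statements merged into one kernel-verified Lean document; each statement's English description precedes it below -/
import Mathlib

section
/- Let X be a geodesic metric space in which every geodesic triangle is δ-slim, where δ ≥ 0. Let γ : ℝ → X be a geodesic line, let c₀, c_M ∈ X, and let x₀ = γ(s₀) and x_M = γ(s_M) be points on the line satisfying: (i) dist(c₀, x₀) = dist(c_M, x_M); (ii) dist(c₀, c_M) ≥ dist(c₀, x₀) + dist(x₀, x_M) + dist(x_M, c_M) − 24δ; and (iii) dist(x₀, x_M) > 28δ + 1. Let σ be any geodesic from c₀ to c_M and let c' = σ(dist(c₀, c_M)/2) be its midpoint. Then the distance from c' to the image of γ is at most 2δ, i.e. inf_{t ∈ ℝ} dist(c', γ(t)) ≤ 2δ. -/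
/-- `σ` is a (unit-speed) geodesic from `a` to `b`, parametrised on
`[0, dist a b]`. -/
def IsGeodesicFromTo {X : Type*} [MetricSpace X] (σ : ℝ → X) (a b : X) : Prop :=
  σ 0 = a ∧ σ (dist a b) = b ∧
    ∀ s ∈ Set.Icc (0 : ℝ) (dist a b), ∀ t ∈ Set.Icc (0 : ℝ) (dist a b),
      dist (σ s) (σ t) = |s - t|

/-- `X` is a geodesic metric space: any two points are joined by a geodesic. -/
def IsGeodesicSpace (X : Type*) [MetricSpace X] : Prop :=
  ∀ a b : X, ∃ σ : ℝ → X, IsGeodesicFromTo σ a b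

/-- All geodesic triangles in `X` are `δ`-slim: every point on one side lies
within distance `δ` of the union of the other two sides. -/
def SlimTriangles (X : Type*) [MetricSpace X] (δ : ℝ) : Prop :=
  ∀ a b c : X, ∀ σab σbc σac : ℝ → X,
    IsGeodesicFromTo σab a b → IsGeodesicFromTo σbc b c → IsGeodesicFromTo σac a c →
    ∀ t ∈ Set.Icc (0 : ℝ) (dist a c),
      (∃ s ∈ Set.Icc (0 : ℝ) (dist a b), dist (σac t) (σab s) ≤ δ) ∨
      (∃ s ∈ Set.Icc (0 : ℝ) (dist b c), dist (σac t) (σbc s) ≤ δ)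

/-- The midpoint of a geodesic `[c₀, c_M]` lies within `2δ` of a geodesic line
`γ`, given the nearest-point-projection inequality for the projections
`x₀ = γ s₀`, `x_M = γ s_M` and that `dist x₀ x_M > 28δ + 1`. -/
theorem midpoint_close_to_axis
    {X : Type*} [MetricSpace X] (δ : ℝ) (hδ : 0 ≤ δ)
    (hgeo : IsGeodesicSpace X) (hslim : SlimTriangles X δ)
    (γ : ℝ → X) (hγ : ∀ s t : ℝ, dist (γ s) (γ t) = |s - t|)
    (c₀ cM x₀ xM : X) (s₀ sM : ℝ)
    (hx₀ : x₀ = γ s₀) (hxM : xM = γ sM)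
    (h_eq : dist c₀ x₀ = dist cM xM)
    (h_proj : dist c₀ cM ≥ dist c₀ x₀ + dist x₀ xM + dist xM cM - 24 * δ)
    (h_far : dist x₀ xM > 28 * δ + 1)
    (σ : ℝ → X) (hσ : IsGeodesicFromTo σ c₀ cM)
    (c' : X) (hc' : c' = σ (dist c₀ cM / 2)) :
    (⨅ t : ℝ, dist c' (γ t)) ≤ 2 * δ := by
  have key : ∃ t, dist c' (γ t) ≤ 2 * δ := by
    obtain ⟨g, hg, hgγ⟩ : ∃ g : ℝ → X, IsGeodesicFromTo g x₀ xM ∧ ∀ t, ∃ u, g t = γ u := by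
      have hd : dist x₀ xM = |s₀ - sM| := by rw [hx₀, hxM, hγ]
      rcases le_total s₀ sM with h | h
      · refine ⟨fun t => γ (s₀ + t), ⟨by simp [hx₀], ?_, ?_⟩, fun t => ⟨_, rfl⟩⟩
        · rw [hd, abs_of_nonpos (by linarith), hxM]
          show γ _ = γ _
          congr 1
          ring
        · intro s _ t _
          show dist (γ _) (γ _) = _
          rw [hγ]
          congr 1
          ring
      · refine ⟨fun t => γ (s₀ - t), ⟨by simp [hx₀], ?_, ?_⟩, fun t => ⟨_, rfl⟩⟩
        · rw [hd, abs_of_nonneg (by linarith), hxM]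
          show γ _ = γ _
          congr 1
          ring
        · intro s _ t _
          show dist (γ _) (γ _) = _
          rw [hγ, abs_sub_comm s t]
          congr 1
          ring
    obtain ⟨a, ha⟩ := hgeo c₀ x₀
    obtain ⟨d, hd⟩ := hgeo x₀ cM
    obtain ⟨b, hb⟩ := hgeo xM cM
    have hD : 0 ≤ dist c₀ cM := dist_nonneg
    have hmem : dist c₀ cM / 2 ∈ Set.Icc (0 : ℝ) (dist c₀ cM) :=
      ⟨by linarith, by linarith⟩
    have h1 : dist c₀ c' = dist c₀ cM / 2 := by
      have := hσ.2.2 0 ⟨le_refl _, hD⟩ _ hmem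
      rw [hσ.1, ← hc', zero_sub, abs_neg, abs_of_nonneg hmem.1] at this
      exact this
    have h2 : dist c' cM = dist c₀ cM / 2 := by
      have := hσ.2.2 _ hmem _ ⟨hD, le_refl _⟩
      rw [hσ.2.1, ← hc', abs_of_nonpos (by linarith)] at this
      linarith
    have hcomm := dist_comm xM cM
    rcases hslim _ _ _ a d σ ha hd hσ _ hmem with ⟨s, hs, h⟩ | ⟨s, hs, h⟩
    · exfalso
      rw [← hc'] at h
      have h3 := ha.2.2 0 ⟨le_refl _, dist_nonneg⟩ s hs
      rw [ha.1, zero_sub, abs_neg, abs_of_nonneg hs.1] at h3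
      have h4 := dist_triangle c₀ (a s) c'
      rw [dist_comm (a s) c'] at h4
      linarith [hs.2]
    · rw [← hc'] at h
      rcases hslim _ _ _ g b d hg hb hd s hs with ⟨t, ht, h'⟩ | ⟨t, ht, h'⟩
      · obtain ⟨u, hu⟩ := hgγ t
        refine ⟨u, ?_⟩
        rw [← hu]
        linarith [dist_triangle c' (d s) (g t)]
      · exfalso
        have h3 := hb.2.2 t ht _ ⟨dist_nonneg, le_refl _⟩
        rw [hb.2.1, abs_of_nonpos (by linarith [ht.2])] at h3
        have h4 := dist_triangle c' (d s) (b t)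
        have h5 := dist_triangle c' (b t) cM
        linarith [ht.1]
  obtain ⟨t, ht⟩ := key
  exact (ciInf_le ⟨0, by rintro _ ⟨u, rfl⟩; exact dist_nonneg⟩ t).trans ht
end

section
/- Let X be a metric space, g : X → X an isometry, and m ∈ X a point with g(m) = m. Let c ∈ X, set L = dist(c, g(c)), and let σ : [0, L] → X be a geodesic from c to g(c). Suppose v = σ(s) is a point on this geodesic with dist(v, m) ≤ 1, and let c' = σ(L/2) be the midpoint of the geodesic. Then dist(c', m) ≤ 2 and dist(c', g(c')) ≤ 4. -/
/-- If `g` is an isometry fixing `m`, `σ` is a geodesic from `c` to `g c`, and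
some point `v = σ s` of the geodesic satisfies `dist v m ≤ 1`, then the
midpoint `c'` of the geodesic satisfies `dist c' m ≤ 2` and
`dist c' (g c') ≤ 4`. -/
theorem midpoint_close_to_fixed_point
    {X : Type*} [MetricSpace X] (g : X → X)
    (hg : ∀ x y : X, dist (g x) (g y) = dist x y)
    (m : X) (hm : g m = m) (c : X) (L : ℝ) (hL : L = dist c (g c))
    (σ : ℝ → X) (hσ : IsGeodesicFromTo σ c (g c))
    (s : ℝ) (hs : s ∈ Set.Icc (0 : ℝ) L)
    (v : X) (hv : v = σ s) (hvm : dist v m ≤ 1)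
    (c' : X) (hc' : c' = σ (L / 2)) :
    dist c' m ≤ 2 ∧ dist c' (g c') ≤ 4 := by
  obtain ⟨h0, h1, h⟩ := hσ
  rw [← hL] at h1 h
  obtain ⟨hs0, hsL⟩ := hs
  have hL0 : 0 ≤ L := hs0.trans hsL
  have e0 : dist c v = s := by
    have := h 0 ⟨le_rfl, hL0⟩ s ⟨hs0, hsL⟩
    rw [h0, ← hv, zero_sub, abs_neg, abs_of_nonneg hs0] at this
    exact this
  have e1 : dist (g c) v = L - s := by
    have := h L ⟨hL0, le_rfl⟩ s ⟨hs0, hsL⟩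
    rw [h1, ← hv, abs_of_nonneg (sub_nonneg.2 hsL)] at this
    exact this
  have e2 : dist c' v = |L / 2 - s| := by
    rw [hc', hv]
    exact h (L / 2) ⟨by linarith, by linarith⟩ s ⟨hs0, hsL⟩
  have e3 : dist (g c) m = dist c m := by
    have := hg c m
    rwa [hm] at this
  have t1 := dist_triangle c v m
  have t2 := dist_triangle (g c) v m
  have t3 := dist_triangle_right c v m
  have t4 := dist_triangle_right (g c) v m
  have e4 : |L / 2 - s| ≤ 1 := abs_le.2 ⟨by linarith, by linarith⟩
  have key : dist c' m ≤ 2 := by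
    have := dist_triangle c' v m
    linarith
  refine ⟨key, ?_⟩
  have e5 : dist (g c') m = dist c' m := by
    have := hg c' m
    rwa [hm] at this
  have := dist_triangle_right c' (g c') m
  linarith
end
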